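/- arXiv:2507.20563 — 3 statements merged into one kernel-verified Lean document; each statement's English description precedes it below -/
import Mathlib

section
/- Let G = [[A, B], [C, D]] be a symplectic matrix with ℓ×ℓ blocks. Suppose the first column of C is zero and the first column of A equals a·e₁ for some nonzero a ∈ F (where e₁ is the first standard basis column vector, i.e. A has a in position (1,1) and 0 in positions (i,1) for i > 1). Then the first row of C is zero and the first row of D equals a⁻¹·e₁ᵀ (i.e. D has a⁻¹ in position (1,1) and 0 in positions (1,j) for j > 1). -/
open Matrix

theorem first_row_CD_of_standard_first_column {F : Type*} [Field F] {l : ℕ} (hl : 0 < l)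
    (A B C D : Matrix (Fin l) (Fin l) F) (a : F) (ha : a ≠ 0)
    (hsymp : (Matrix.fromBlocks A B C D)ᵀ *
        (Matrix.fromBlocks 0 1 (-1) 0 : Matrix (Fin l ⊕ Fin l) (Fin l ⊕ Fin l) F) *
        Matrix.fromBlocks A B C D =
      Matrix.fromBlocks 0 1 (-1) 0)
    (hC : ∀ i : Fin l, C i ⟨0, hl⟩ = 0)
    (hA0 : A ⟨0, hl⟩ ⟨0, hl⟩ = a)
    (hA : ∀ i : Fin l, i ≠ ⟨0, hl⟩ → A i ⟨0, hl⟩ = 0) :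
    (∀ j : Fin l, C ⟨0, hl⟩ j = 0) ∧
    D ⟨0, hl⟩ ⟨0, hl⟩ = a⁻¹ ∧
    (∀ j : Fin l, j ≠ ⟨0, hl⟩ → D ⟨0, hl⟩ j = 0) := by
  rw [fromBlocks_transpose, fromBlocks_multiply, fromBlocks_multiply, fromBlocks_inj] at hsymp
  obtain ⟨hAC, hAD, -, -⟩ := hsymp
  have hAmul (M : Matrix (Fin l) (Fin l) F) (j : Fin l) :
      (Aᵀ * M) ⟨0, hl⟩ j = a * M ⟨0, hl⟩ j := by
    rw [mul_apply, Finset.sum_eq_single ⟨0, hl⟩ (fun i _ hi => by simp [hA i hi]) (by simp),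
      transpose_apply, hA0]
  have hCmul (M : Matrix (Fin l) (Fin l) F) (j : Fin l) : (Cᵀ * M) ⟨0, hl⟩ j = 0 := by
    simp [mul_apply, hC]
  have hCrow (j : Fin l) : a * C ⟨0, hl⟩ j = 0 := by
    simpa [hAmul, hCmul] using congr_fun₂ hAC ⟨0, hl⟩ j
  have hDrow (j : Fin l) : a * D ⟨0, hl⟩ j = (1 : Matrix (Fin l) (Fin l) F) ⟨0, hl⟩ j := by
    simpa [hAmul, hCmul] using congr_fun₂ hAD ⟨0, hl⟩ j
  refine ⟨fun j => (mul_eq_zero.mp (hCrow j)).resolve_left ha, ?_, fun j hj => ?_⟩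
  · exact eq_inv_of_mul_eq_one_right (by simpa using hDrow ⟨0, hl⟩)
  · exact (mul_eq_zero.mp ((hDrow j).trans (one_apply_ne hj.symm))).resolve_left ha
end

section
/- Let G = [[A, B], [C, D]] be a symplectic matrix with ℓ×ℓ blocks. Suppose the first column of B is zero and the first column of D equals d·e₁ for some nonzero d ∈ F (where e₁ is the first standard basis column vector, i.e. D has d in position (1,1) and 0 in positions (i,1) for i > 1). Then the first row of B is zero and the first row of A equals d⁻¹·e₁ᵀ (i.e. A has d⁻¹ in position (1,1) and 0 in positions (1,j) for j > 1). -/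
open Matrix

theorem first_row_BA_of_standard_column {F : Type*} [Field F] {l : ℕ} (hl : 0 < l)
    (A B C D : Matrix (Fin l) (Fin l) F) (d : F) (hd : d ≠ 0)
    (hsymp : (Matrix.fromBlocks A B C D)ᵀ *
        (Matrix.fromBlocks 0 1 (-1) 0 : Matrix (Fin l ⊕ Fin l) (Fin l ⊕ Fin l) F) *
        Matrix.fromBlocks A B C D =
      Matrix.fromBlocks 0 1 (-1) 0)
    (hB : ∀ i : Fin l, B i ⟨0, hl⟩ = 0)
    (hD0 : D ⟨0, hl⟩ ⟨0, hl⟩ = d)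
    (hD : ∀ i : Fin l, i ≠ ⟨0, hl⟩ → D i ⟨0, hl⟩ = 0) :
    (∀ j : Fin l, B ⟨0, hl⟩ j = 0) ∧
    A ⟨0, hl⟩ ⟨0, hl⟩ = d⁻¹ ∧
    (∀ j : Fin l, j ≠ ⟨0, hl⟩ → A ⟨0, hl⟩ j = 0) := by
  have mul_D (M : Matrix (Fin l) (Fin l) F) (j : Fin l) :
      (Mᵀ * D) j ⟨0, hl⟩ = M ⟨0, hl⟩ j * d := by
    rw [Matrix.mul_apply, Finset.sum_eq_single ⟨0, hl⟩ (fun i _ hi => by rw [hD i hi, mul_zero])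
      (fun h => absurd (Finset.mem_univ _) h), hD0, Matrix.transpose_apply]
  have mul_B (M : Matrix (Fin l) (Fin l) F) (j : Fin l) : (Mᵀ * B) j ⟨0, hl⟩ = 0 := by
    simp [Matrix.mul_apply, hB]
  simp only [Matrix.fromBlocks_transpose, Matrix.fromBlocks_multiply, Matrix.fromBlocks_inj,
    Matrix.mul_zero, Matrix.mul_one, Matrix.mul_neg, Matrix.neg_mul, zero_add, add_zero] at hsymp
  obtain ⟨-, hAD, -, hBD⟩ := hsymp
  have hA (j : Fin l) : A ⟨0, hl⟩ j * d = (1 : Matrix (Fin l) (Fin l) F) j ⟨0, hl⟩ := by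
    rw [← hAD, Matrix.add_apply, Matrix.neg_apply, mul_B, mul_D, neg_zero, zero_add]
  refine ⟨fun j => ?_, ?_, fun j hj => ?_⟩
  · have h := congr_fun₂ hBD j ⟨0, hl⟩
    rw [Matrix.add_apply, Matrix.neg_apply, mul_B, mul_D, neg_zero, zero_add] at h
    exact (mul_eq_zero.mp h).resolve_right hd
  · exact eq_inv_of_mul_eq_one_left ((hA _).trans (Matrix.one_apply_eq _))
  · exact (mul_eq_zero.mp ((hA j).trans (Matrix.one_apply_ne hj))).resolve_right hd
end

section
/- Let G be a symplectic 2ℓ×2ℓ matrix over F, let 1 ≤ m ≤ ℓ, and suppose that for every k ≤ m the k-th column of G is a standard column (its only nonzero entry is in position k), the (ℓ+k)-th column of G is a standard column (its only nonzero entry is in position ℓ+k), the k-th row of G is a standard row, and the (ℓ+k)-th row of G is a standard row. Then the submatrix of G obtained by restricting rows and columns to the index set {m+1, …, ℓ} ∪ {ℓ+m+1, …, 2ℓ} is a symplectic matrix of size 2(ℓ−m), i.e. it satisfies Xᵀ·J′·X = J′ where J′ = [[0, I_{ℓ−m}], [−I_{ℓ−m}, 0]]. -/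
open Matrix

theorem Matrix.transpose_mul_fromBlocks_mul_apply {n R : Type*} [Fintype n] [DecidableEq n]
    [CommRing R] (G : Matrix (n ⊕ n) (n ⊕ n) R) (a b : n ⊕ n) :
    (Gᵀ * (Matrix.fromBlocks 0 1 (-1) 0 : Matrix (n ⊕ n) (n ⊕ n) R) * G) a b =
      ∑ k, (G (Sum.inl k) a * G (Sum.inr k) b - G (Sum.inr k) a * G (Sum.inl k) b) := by
  simp [Matrix.mul_apply, Matrix.one_apply, Finset.sum_sub_distrib]
  ring

/-- If the selected columns of a symplectic matrix vanish on the non-selected rows of the upper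
half, then the submatrix on the selected indices is symplectic. -/
theorem Matrix.submatrix_symplectic_of_injective {n p R : Type*} [Fintype n] [DecidableEq n]
    [Fintype p] [DecidableEq p] [CommRing R] (e : p → n) (he : Function.Injective e)
    (G : Matrix (n ⊕ n) (n ⊕ n) R)
    (hG : Gᵀ * (Matrix.fromBlocks 0 1 (-1) 0 : Matrix (n ⊕ n) (n ⊕ n) R) * G =
      Matrix.fromBlocks 0 1 (-1) 0)
    (hzero : ∀ k, k ∉ Set.range e → ∀ c, G (Sum.inl k) (Sum.map e e c) = 0) :
    (G.submatrix (Sum.map e e) (Sum.map e e))ᵀ *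
        (Matrix.fromBlocks 0 1 (-1) 0 : Matrix (p ⊕ p) (p ⊕ p) R) *
        G.submatrix (Sum.map e e) (Sum.map e e) =
      Matrix.fromBlocks 0 1 (-1) 0 := by
  ext a b
  have hab := congrFun (congrFun hG (Sum.map e e a)) (Sum.map e e b)
  rw [Matrix.transpose_mul_fromBlocks_mul_apply] at hab ⊢
  refine (Fintype.sum_of_injective e he _ _ (fun k hk => ?_) (fun _ => rfl)).trans
    (hab.trans ?_)
  · simp [hzero k hk]
  · rcases a with a | a <;> rcases b with b | b <;> simp [Matrix.one_apply, he.eq_iff]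

theorem submatrix_symplectic_of_standard {F : Type*} [Field F] {l : ℕ} (hl : 0 < l)
    (m : ℕ) (hm1 : 1 ≤ m) (hml : m ≤ l)
    (G : Matrix (Fin l ⊕ Fin l) (Fin l ⊕ Fin l) F)
    (hsymp : Gᵀ * (Matrix.fromBlocks 0 1 (-1) 0 : Matrix (Fin l ⊕ Fin l) (Fin l ⊕ Fin l) F) *
        G = Matrix.fromBlocks 0 1 (-1) 0)
    (hcol₁ : ∀ k : Fin l, (k : ℕ) < m →
      (∀ r, r ≠ Sum.inl k → G r (Sum.inl k) = 0) ∧ G (Sum.inl k) (Sum.inl k) ≠ 0)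
    (hcol₂ : ∀ k : Fin l, (k : ℕ) < m →
      (∀ r, r ≠ Sum.inr k → G r (Sum.inr k) = 0) ∧ G (Sum.inr k) (Sum.inr k) ≠ 0)
    (hrow₁ : ∀ k : Fin l, (k : ℕ) < m →
      (∀ c, c ≠ Sum.inl k → G (Sum.inl k) c = 0) ∧ G (Sum.inl k) (Sum.inl k) ≠ 0)
    (hrow₂ : ∀ k : Fin l, (k : ℕ) < m →
      (∀ c, c ≠ Sum.inr k → G (Sum.inr k) c = 0) ∧ G (Sum.inr k) (Sum.inr k) ≠ 0) :
    (G.submatrix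
          (Sum.map (fun x : Fin (l - m) => (⟨m + x.val, by have := x.isLt; omega⟩ : Fin l))
            (fun x : Fin (l - m) => (⟨m + x.val, by have := x.isLt; omega⟩ : Fin l)))
          (Sum.map (fun x : Fin (l - m) => (⟨m + x.val, by have := x.isLt; omega⟩ : Fin l))
            (fun x : Fin (l - m) => (⟨m + x.val, by have := x.isLt; omega⟩ : Fin l))))ᵀ *
        (Matrix.fromBlocks 0 1 (-1) 0 :
          Matrix (Fin (l - m) ⊕ Fin (l - m)) (Fin (l - m) ⊕ Fin (l - m)) F) *
        G.submatrix
          (Sum.map (fun x : Fin (l - m) => (⟨m + x.val, by have := x.isLt; omega⟩ : Fin l))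
            (fun x : Fin (l - m) => (⟨m + x.val, by have := x.isLt; omega⟩ : Fin l)))
          (Sum.map (fun x : Fin (l - m) => (⟨m + x.val, by have := x.isLt; omega⟩ : Fin l))
            (fun x : Fin (l - m) => (⟨m + x.val, by have := x.isLt; omega⟩ : Fin l))) =
      Matrix.fromBlocks 0 1 (-1) 0 := by
  refine Matrix.submatrix_symplectic_of_injective _ (fun x y hxy => ?_) G hsymp
    (fun k hk c => ?_)
  · simpa [Fin.ext_iff] using hxy
  · have hkm : (k : ℕ) < m := by
      by_contra hge
      exact hk ⟨⟨k - m, by omega⟩, Fin.ext (by simp only; omega)⟩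
    refine (hrow₁ k hkm).1 _ ?_
    rcases c with c | c
    · simp only [Sum.map_inl, ne_eq, Sum.inl.injEq, Fin.ext_iff]
      omega
    · simp
end
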